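/- arXiv:1701.05108 — 3 statements merged into one kernel-verified Lean document; each statement's English description precedes it below -/
import Mathlib

section
/- Let G = (V(G), E(G)) be a finite simple undirected graph with n vertices and m edges, and let h ∈ ℕ with h > 3 and m ≥ n + h(h−1)/2 − h − 1. Consider the election with candidates C = {p, g} and voter set V consisting of: one g-voter w_u for each vertex u ∈ V(G) with κ(w_u) = {w_u}; one p-voter w_e for each edge e = {u, u'} ∈ E(G) with κ(w_e) = {w_e, w_u, w_{u'}}; and m − n − (h(h−1)/2 − h − 1) additional dummy g-voters, each with singleton bundle (so that s_p(V) − s_g(V) = h(h−1)/2 − h − 1). Then G has a clique of size h if and only if there exists V' ⊆ V with |V'| ≤ h(h−1)/2 such that p is NOT a Plurality winner of (C, V ∖ κ(V')). -/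
/-- Voters of the Clique reduction for C-Des-Del: one g-voter per vertex
(singleton bundle), one p-voter per edge (bundled with its endpoints' voters),
and m − n − (h(h−1)/2 − h − 1) dummy g-voters with singleton bundles. -/
abbrev Voter7 {V : Type*} [Fintype V] [DecidableEq V]
    (G : SimpleGraph V) [DecidableRel G.Adj] (h : ℕ) :=
  V ⊕ ({e : Sym2 V // e ∈ G.edgeFinset} ⊕
    Fin (G.edgeFinset.card - Fintype.card V - (h * (h - 1) / 2 - h - 1)))

/-- Non-loops with both ends in `T` are unordered pairs of distinct elements of `T`. -/
theorem subset_image_offDiag {V : Type*} [DecidableEq V] {A : Finset (Sym2 V)} {T : Finset V}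
    (hdiag : ∀ e ∈ A, ¬ e.IsDiag) (hT : ∀ e ∈ A, ∀ u ∈ e, u ∈ T) :
    A ⊆ T.offDiag.image Sym2.mk.uncurry := by
  intro e he
  induction e with
  | _ x y =>
    have hxy := hdiag _ he
    simp only [Sym2.mk_isDiag_iff] at hxy
    exact Finset.mem_image.2 ⟨(x, y), Finset.mem_offDiag.2
      ⟨hT _ he x (Sym2.mem_mk_left x y), hT _ he y (Sym2.mem_mk_right x y), hxy⟩, rfl⟩

/-- Among all `t ≤ h`, the surplus `t.choose 2 - t` reaches that of `h > 3` only at `t = h`. -/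
theorem eq_of_choose_two_add_le {t h : ℕ} (hh : 3 < h) (hth : t ≤ h)
    (hle : h.choose 2 + t ≤ t.choose 2 + h) : t = h := by
  by_contra hne
  obtain ⟨k, rfl⟩ : ∃ k, h = t + (k + 1) := ⟨h - t - 1, by omega⟩
  have hQ : ((t + (k + 1)).choose 2 : ℚ) = (t + (k + 1)) * (t + (k + 1) - 1) / 2 := by
    rw [Nat.cast_choose_two]; push_cast; ring
  have hR : (t.choose 2 : ℚ) = t * (t - 1) / 2 := Nat.cast_choose_two ℚ t
  have hle' : ((t + (k + 1)).choose 2 : ℚ) + t ≤ t.choose 2 + (t + (k + 1)) := by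
    exact_mod_cast hle
  have hh' : (4 : ℚ) ≤ t + (k + 1) := by exact_mod_cast hh
  rw [hQ, hR] at hle'
  have hk : (0 : ℚ) ≤ k := k.cast_nonneg
  have ht : (0 : ℚ) ≤ t := t.cast_nonneg
  nlinarith [mul_nonneg hk ht]

theorem card_filter_univ_sdiff_add {α : Type*} [Fintype α] [DecidableEq α] (D : Finset α)
    (P : α → Prop) [DecidablePred P] :
    ((Finset.univ \ D).filter P).card + (D.filter P).card = (Finset.univ.filter P).card := by
  rw [← Finset.card_union_of_disjoint
    (Finset.disjoint_filter_filter Finset.sdiff_disjoint), ← Finset.filter_union,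
    Finset.sdiff_union_of_subset (Finset.subset_univ D)]

/-- Clique reduction for C-Des-Del with two candidates p, g:
G has a clique of size h iff some V' of size ≤ h(h−1)/2 makes p not a
Plurality winner of (C, V ∖ κ(V')). -/
theorem stmt_7 {V C : Type*} [Fintype V] [DecidableEq V] [DecidableEq C]
    (G : SimpleGraph V) [DecidableRel G.Adj]
    (p g : C) (hpg : p ≠ g) (h : ℕ) (hh : 3 < h)
    (hm : Fintype.card V + (h * (h - 1) / 2 - h - 1) ≤ G.edgeFinset.card)
    (κ : Voter7 G h → Finset (Voter7 G h))
    (hκ1 : ∀ u : V, κ (Sum.inl u) = {Sum.inl u})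
    (hκ2 : ∀ e : {e : Sym2 V // e ∈ G.edgeFinset},
      κ (Sum.inr (Sum.inl e)) =
        insert (Sum.inr (Sum.inl e))
          ((Finset.univ.filter (fun u : V => u ∈ (e : Sym2 V))).image Sum.inl))
    (hκ3 : ∀ d, κ (Sum.inr (Sum.inr d)) = {Sum.inr (Sum.inr d)}) :
    (∃ U : Finset V, U.card = h ∧ ∀ x ∈ U, ∀ y ∈ U, x ≠ y → G.Adj x y) ↔
    (∃ V' : Finset (Voter7 G h), V'.card ≤ h * (h - 1) / 2 ∧
      ¬ ∀ c ∈ ({p, g} : Finset C),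
        ((Finset.univ \ V'.biUnion κ).filter
          (fun v => Sum.elim (fun _ => g) (Sum.elim (fun _ => p) (fun _ => g)) v = c)).card ≤
        ((Finset.univ \ V'.biUnion κ).filter
          (fun v => Sum.elim (fun _ => g) (Sum.elim (fun _ => p) (fun _ => g)) v = p)).card) := by
  classical
  set K := h * (h - 1) / 2 with hK
  have hKc : h.choose 2 = K := Nat.choose_two_right h
  have hKh : h + 1 ≤ K := by
    rw [hK, Nat.le_div_iff_mul_le two_pos]
    obtain ⟨j, rfl⟩ : ∃ j, h = j + 4 := ⟨h - 4, by omega⟩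
    rw [show j + 4 - 1 = j + 3 by omega]
    nlinarith
  have hinj : Function.Injective (fun e => (Sum.inr (Sum.inl e) : Voter7 G h)) :=
    Sum.inr_injective.comp Sum.inl_injective
  set f : Voter7 G h → C := Sum.elim (fun _ => g) (Sum.elim (fun _ => p) (fun _ => g)) with hf
  have hp : (Finset.univ.filter (fun v => f v = p)).card = G.edgeFinset.card := by
    have : Finset.univ.filter (fun v => f v = p) =
        Finset.univ.image (fun e => Sum.inr (Sum.inl e)) := by
      ext (u | e | d) <;> simp [hf, hpg.symm]
    rw [this, Finset.card_image_of_injective _ hinj]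
    simp
  have hg : (Finset.univ.filter (fun v => f v = g)).card + (K - h - 1) = G.edgeFinset.card := by
    have hcompl : Finset.univ.filter (fun v => f v = g) =
        Finset.univ.filter (fun v => ¬ f v = p) := by
      ext (u | e | d) <;> simp [hf, hpg, hpg.symm]
    have hadd := Finset.card_filter_add_card_filter_not (s := (Finset.univ : Finset (Voter7 G h)))
      (fun v => f v = p)
    rw [← hcompl, hp, Finset.card_univ, Fintype.card_sum, Fintype.card_sum, Fintype.card_fin,
      Fintype.card_coe] at hadd
    omega
  have key : ∀ D : Finset (Voter7 G h),
      (¬ ∀ c ∈ ({p, g} : Finset C), ((Finset.univ \ D).filter (fun v => f v = c)).card ≤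
        ((Finset.univ \ D).filter (fun v => f v = p)).card) ↔
      (D.filter (fun v => f v = g)).card + K ≤ (D.filter (fun v => f v = p)).card + h := by
    intro D
    have h1 := card_filter_univ_sdiff_add D (fun v => f v = p)
    have h2 := card_filter_univ_sdiff_add D (fun v => f v = g)
    simp only [Finset.mem_insert, Finset.mem_singleton, forall_eq_or_imp, forall_eq, le_refl,
      true_and, not_le]
    omega
  simp only [key]
  constructor
  · rintro ⟨U, hU, hadj⟩
    set A : Finset (Sym2 V) := U.offDiag.image Sym2.mk.uncurry with hA
    have hAU : ∀ e ∈ A, ∀ u ∈ e, u ∈ U := by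
      intro e he u hu
      obtain ⟨⟨x, y⟩, hxy, rfl⟩ := Finset.mem_image.1 he
      rw [Finset.mem_offDiag] at hxy
      rcases Sym2.mem_iff.1 hu with rfl | rfl
      exacts [hxy.1, hxy.2.1]
    have hAE : ∀ e ∈ A, e ∈ G.edgeFinset := by
      intro e he
      obtain ⟨⟨x, y⟩, hxy, rfl⟩ := Finset.mem_image.1 he
      rw [Finset.mem_offDiag] at hxy
      simpa using hadj x hxy.1 y hxy.2.1 hxy.2.2
    have hAcard : A.card = K := by rw [hA, Sym2.card_image_offDiag, hU, hKc]
    set V' : Finset (Voter7 G h) :=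
      (A.subtype (· ∈ G.edgeFinset)).image (fun e => Sum.inr (Sum.inl e)) with hV'
    have hVcard : V'.card = K := by
      rw [hV', Finset.card_image_of_injective _ hinj,
        Finset.card_subtype, Finset.filter_true_of_mem hAE, hAcard]
    refine ⟨V', hVcard.le, ?_⟩
    have hdel : V' ⊆ (V'.biUnion κ).filter (fun v => f v = p) := by
      intro v hv
      obtain ⟨e, -, rfl⟩ := Finset.mem_image.1 hv
      exact Finset.mem_filter.2 ⟨Finset.mem_biUnion.2 ⟨_, hv, by simp [hκ2]⟩, rfl⟩
    have hloss : (V'.biUnion κ).filter (fun v => f v = g) ⊆ U.image Sum.inl := by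
      intro v hv
      obtain ⟨hv, hvg⟩ := Finset.mem_filter.1 hv
      obtain ⟨w, hw, hvw⟩ := Finset.mem_biUnion.1 hv
      obtain ⟨e, he, rfl⟩ := Finset.mem_image.1 hw
      rw [hκ2, Finset.mem_insert] at hvw
      rcases hvw with rfl | hvw
      · exact absurd hvg hpg
      · obtain ⟨u, hu, rfl⟩ := Finset.mem_image.1 hvw
        exact Finset.mem_image_of_mem _
          (hAU _ (Finset.mem_subtype.1 he) _ (Finset.mem_filter.1 hu).2)
    have h1 := Finset.card_le_card hdel
    have h2 := (Finset.card_le_card hloss).trans Finset.card_image_le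
    omega
  · rintro ⟨V', hV', hle⟩
    set D := V'.biUnion κ with hD
    have hmem : ∀ e, Sum.inr (Sum.inl e) ∈ D → Sum.inr (Sum.inl e) ∈ V' := by
      intro e he
      obtain ⟨w, hw, hew⟩ := Finset.mem_biUnion.1 he
      rcases w with u | e' | d
      · simp [hκ1] at hew
      · rw [hκ2] at hew
        simp at hew
        rwa [hew]
      · simp [hκ3] at hew
    set E : Finset {e : Sym2 V // e ∈ G.edgeFinset} :=
      Finset.univ.filter (fun e => Sum.inr (Sum.inl e) ∈ V') with hE
    set A : Finset (Sym2 V) := E.image Subtype.val with hA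
    set T : Finset V := Finset.univ.filter (fun u => ∃ e ∈ A, u ∈ e) with hT
    have hAE : ∀ e ∈ A, e ∈ G.edgeFinset := by
      intro e he
      obtain ⟨e, -, rfl⟩ := Finset.mem_image.1 he
      exact e.2
    have hAT : A ⊆ T.offDiag.image Sym2.mk.uncurry := subset_image_offDiag
      (fun e he => G.not_isDiag_of_mem_edgeFinset (hAE e he))
      (fun e he u hu => Finset.mem_filter.2 ⟨Finset.mem_univ _, e, he, hu⟩)
    have hAcard : A.card = E.card := Finset.card_image_of_injective _ Subtype.val_injective
    have hdel : (D.filter (fun v => f v = p)).card ≤ E.card := by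
      refine (Finset.card_le_card ?_).trans
        (Finset.card_image_le (f := fun e => (Sum.inr (Sum.inl e) : Voter7 G h)))
      rintro (u | e | d) hv
      · exact absurd (Finset.mem_filter.1 hv).2 hpg.symm
      · exact Finset.mem_image_of_mem _
          (Finset.mem_filter.2 ⟨Finset.mem_univ _, hmem e (Finset.mem_filter.1 hv).1⟩)
      · exact absurd (Finset.mem_filter.1 hv).2 hpg.symm
    have hEV : E.card ≤ V'.card := by
      refine Finset.card_le_card_of_injOn (fun e => Sum.inr (Sum.inl e))
        (fun e he => (Finset.mem_filter.1 he).2)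
        hinj.injOn
    have hloss : T.card ≤ (D.filter (fun v => f v = g)).card := by
      refine Finset.card_le_card_of_injOn Sum.inl ?_ Sum.inl_injective.injOn
      intro u hu
      obtain ⟨e, he, hue⟩ := (Finset.mem_filter.1 hu).2
      obtain ⟨e, heE, rfl⟩ := Finset.mem_image.1 he
      have heV : Sum.inr (Sum.inl e) ∈ V' := (Finset.mem_filter.1 heE).2
      refine Finset.mem_filter.2 ⟨Finset.mem_biUnion.2 ⟨_, heV, ?_⟩, rfl⟩
      simp [hκ2, hue]
    have hcard := Finset.card_le_card hAT
    rw [Sym2.card_image_offDiag] at hcard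
    have hTh : T.card = h := eq_of_choose_two_add_le hh (by omega) (by omega)
    have hAeq : A = T.offDiag.image Sym2.mk.uncurry := by
      refine Finset.eq_of_subset_of_card_le hAT ?_
      rw [Sym2.card_image_offDiag, hTh]
      omega
    refine ⟨T, hTh, fun x hx y hy hxy => ?_⟩
    have : s(x, y) ∈ A := hAeq ▸
      Finset.mem_image.2 ⟨(x, y), Finset.mem_offDiag.2 ⟨hx, hy, hxy⟩, rfl⟩
    simpa using hAE _ this
end

section
/- Let W = {w_1, …, w_N} be voters, each with favorite candidate in {p, g}, and let κ be the symmetric bundling function whose bundling graph is the path w_1 − w_2 − ⋯ − w_N, i.e., κ(w_i) = {w_{i−1}, w_i, w_{i+1}} ∩ W. Suppose W' is a maximum (s,t)-proper-subset and W' = W_1 ∪ W_2 for some j with s ≤ j < t, where W_1 is an (s,j)-proper-subset and W_2 is a (j+1,t)-proper-subset. Then W_1 is a maximum (s,j)-proper-subset and W_2 is a maximum (j+1,t)-proper-subset. -/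
/-- The path bundling function on voters w_1, …, w_N (modelled by their
indices): κ(w_i) = {w_{i−1}, w_i, w_{i+1}} ∩ W. -/
def bun (N : ℕ) (i : ℕ) : Finset ℕ :=
  ({i - 1, i, i + 1} : Finset ℕ) ∩ Finset.Icc 1 N

/-- κ(W') = ⋃_{w ∈ W'} κ(w). -/
def bunU (N : ℕ) (W' : Finset ℕ) : Finset ℕ := W'.biUnion (bun N)

/-- W(s,t) = {w_i : s ≤ i ≤ t}. -/
def wst (N s t : ℕ) : Finset ℕ := Finset.Icc s t ∩ Finset.Icc 1 N

/-- gap(W') = s_p(κ(W')) − s_g(κ(W')). -/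
def gap {C : Type*} [DecidableEq C] (N : ℕ) (fav : ℕ → C) (p g : C)
    (W' : Finset ℕ) : ℤ :=
  (((bunU N W').filter (fun i => fav i = p)).card : ℤ) -
    (((bunU N W').filter (fun i => fav i = g)).card : ℤ)

/-- An (s,t)-proper-subset: W' ⊆ W(s,t) with κ(W') ⊆ W(s,t). -/
def ProperSubset (N s t : ℕ) (W' : Finset ℕ) : Prop :=
  W' ⊆ wst N s t ∧ bunU N W' ⊆ wst N s t

/-- A maximum (s,t)-proper-subset: an (s,t)-proper-subset whose gap is largest
among all (s,t)-proper-subsets of the same cardinality. -/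
def MaxProperSubset {C : Type*} [DecidableEq C] (N : ℕ) (fav : ℕ → C) (p g : C)
    (s t : ℕ) (W' : Finset ℕ) : Prop :=
  ProperSubset N s t W' ∧
    ∀ W'' : Finset ℕ, ProperSubset N s t W'' → W''.card = W'.card →
      gap N fav p g W'' ≤ gap N fav p g W'

theorem disjoint_wst (N s j t : ℕ) : Disjoint (wst N s j) (wst N (j + 1) t) := by
  rw [Finset.disjoint_left]
  intro x hx hy
  simp only [wst, Finset.mem_inter, Finset.mem_Icc] at hx hy
  omega

theorem ProperSubset.mono {N s t s' t' : ℕ} {A : Finset ℕ} (h : ProperSubset N s t A)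
    (hs : s' ≤ s) (ht : t ≤ t') : ProperSubset N s' t' A :=
  have hw : wst N s t ⊆ wst N s' t' :=
    Finset.inter_subset_inter_right (Finset.Icc_subset_Icc hs ht)
  ⟨h.1.trans hw, h.2.trans hw⟩

theorem bunU_union (N : ℕ) (A B : Finset ℕ) : bunU N (A ∪ B) = bunU N A ∪ bunU N B :=
  Finset.union_biUnion

theorem ProperSubset.union {N s t : ℕ} {A B : Finset ℕ} (hA : ProperSubset N s t A)
    (hB : ProperSubset N s t B) : ProperSubset N s t (A ∪ B) :=
  ⟨Finset.union_subset hA.1 hB.1, bunU_union N A B ▸ Finset.union_subset hA.2 hB.2⟩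

/-- The gap is additive on sets whose bundles are disjoint. -/
theorem gap_union {C : Type*} [DecidableEq C] {N : ℕ} (fav : ℕ → C) (p g : C)
    {A B : Finset ℕ} (h : Disjoint (bunU N A) (bunU N B)) :
    gap N fav p g (A ∪ B) = gap N fav p g A + gap N fav p g B := by
  simp only [gap, bunU_union, Finset.filter_union]
  rw [Finset.card_union_of_disjoint (Finset.disjoint_filter_filter h),
    Finset.card_union_of_disjoint (Finset.disjoint_filter_filter h)]
  push_cast
  ring

/-- Replacing both parts of a maximum proper subset by proper subsets of the same sizes
does not increase the total gap. -/
theorem MaxProperSubset.gap_add_gap_le {C : Type*} [DecidableEq C] {N : ℕ} {fav : ℕ → C}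
    {p g : C} {s j t : ℕ} (hsj : s ≤ j) (hjt : j < t) {W₁ W₂ A B : Finset ℕ}
    (hmax : MaxProperSubset N fav p g s t (W₁ ∪ W₂))
    (h1 : ProperSubset N s j W₁) (h2 : ProperSubset N (j + 1) t W₂)
    (hA : ProperSubset N s j A) (hB : ProperSubset N (j + 1) t B)
    (hcA : A.card = W₁.card) (hcB : B.card = W₂.card) :
    gap N fav p g A + gap N fav p g B ≤ gap N fav p g W₁ + gap N fav p g W₂ := by
  have hd := disjoint_wst N s j t
  rw [← gap_union fav p g (hd.mono hA.2 hB.2), ← gap_union fav p g (hd.mono h1.2 h2.2)]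
  refine hmax.2 _ ((hA.mono le_rfl hjt.le).union (hB.mono (by omega) le_rfl)) ?_
  rw [Finset.card_union_of_disjoint (hd.mono hA.1 hB.1),
    Finset.card_union_of_disjoint (hd.mono h1.1 h2.1), hcA, hcB]

/-- Optimality of the split: if a maximum (s,t)-proper-subset is the union of
an (s,j)-proper-subset and a (j+1,t)-proper-subset, then both parts are
themselves maximum proper subsets. -/
theorem stmt_10 {C : Type*} [DecidableEq C] (N : ℕ) (fav : ℕ → C)
    (p g : C) (hpg : p ≠ g)
    (hfav : ∀ i ∈ Finset.Icc 1 N, fav i = p ∨ fav i = g)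
    (s j t : ℕ) (hsj : s ≤ j) (hjt : j < t)
    (W' W₁ W₂ : Finset ℕ)
    (hmax : MaxProperSubset N fav p g s t W')
    (hunion : W' = W₁ ∪ W₂)
    (h1 : ProperSubset N s j W₁)
    (h2 : ProperSubset N (j + 1) t W₂) :
    MaxProperSubset N fav p g s j W₁ ∧ MaxProperSubset N fav p g (j + 1) t W₂ := by
  subst hunion
  refine ⟨⟨h1, fun A hA hc => ?_⟩, ⟨h2, fun B hB hc => ?_⟩⟩
  · have := hmax.gap_add_gap_le hsj hjt h1 h2 hA h2 hc rfl
    linarith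
  · have := hmax.gap_add_gap_le hsj hjt h1 h2 h1 hB rfl hc
    linarith
end

section
/- Let G = (V(G), E(G)) be a finite, connected, simple undirected graph with at least two vertices, and let h ∈ ℕ with h ≥ 3. Consider the election with candidates C = {p} ∪ {g_e : e ∈ E(G)}, registered voters V consisting of h − 1 g_e-voters for each edge e ∈ E(G), and unregistered voters W consisting, for each vertex u ∈ V(G), of a gadget B_u containing one p-voter p_u and one g_e-voter a_e^u for each edge e incident to u; the bundling function on W assigns to every voter of the gadget B_u the whole gadget B_u as its bundle. Then κ is disjoint, and G has an independent set of size h if and only if there exists W' ⊆ W with |W'| ≤ h such that p is a Plurality winner of (C, V ∪ κ(W')). -/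
/-- The gadget voters of the Independent Set reduction: for each vertex u, the
gadget B_u contains one p-voter (`⟨u, none⟩`) and one g_e-voter `⟨u, some e⟩`
for each edge e incident to u. -/
abbrev Gadget11 {V : Type*} [Fintype V] [DecidableEq V]
    (G : SimpleGraph V) [DecidableRel G.Adj] :=
  Σ u : V, Option {e : Sym2 V // e ∈ G.edgeFinset ∧ u ∈ e}

/-- Favorite candidates of the gadget voters: `none` is the preferred
candidate p; `some e` is the edge candidate g_e. -/
def fav11 {V : Type*} [Fintype V] [DecidableEq V]
    (G : SimpleGraph V) [DecidableRel G.Adj] :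
    Gadget11 G → Option {e : Sym2 V // e ∈ G.edgeFinset}
  | ⟨_, none⟩ => none
  | ⟨_, some ⟨e, he⟩⟩ => some ⟨e, he.1⟩

open Finset in
theorem card_filter_image_inl_union_image_inr {α β γ : Type*} [DecidableEq α] [DecidableEq β]
    (A : Finset α) (B : Finset β) (f : α → γ) (g : β → γ) (c : γ)
    [DecidablePred fun a => f a = c] [DecidablePred fun b => g b = c]
    [DecidablePred fun v => Sum.elim f g v = c] :
    ((A.image Sum.inl ∪ B.image Sum.inr).filter (fun v => Sum.elim f g v = c)).card =
      (A.filter (fun a => f a = c)).card + (B.filter (fun b => g b = c)).card := by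
  rw [filter_union, filter_image, filter_image, card_union_of_disjoint,
    card_image_of_injective _ Sum.inl_injective, card_image_of_injective _ Sum.inr_injective]
  · congr!
  · simp [disjoint_left]

section GadgetScores

open Finset

variable {V : Type*} [Fintype V] [DecidableEq V] (G : SimpleGraph V) [DecidableRel G.Adj]

theorem card_filter_fav11_eq_none (T : Finset V) [DecidablePred fun w => fav11 G w = none] :
    (((univ : Finset (Gadget11 G)).filter (fun w => w.1 ∈ T)).filter
      (fun w => fav11 G w = none)).card = T.card := by
  symm
  refine card_bij (fun u _ => ⟨u, none⟩) (fun u hu => by simp only [mem_filter]; simp [hu, fav11])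
    (fun u _ v _ huv => congrArg Sigma.fst huv) ?_
  rintro ⟨u, _ | ⟨e, he⟩⟩ hw
  · exact ⟨u, (mem_filter.1 (mem_filter.1 hw).1).2, rfl⟩
  · cases (mem_filter.1 hw).2

theorem card_filter_fav11_eq_some (T : Finset V) (e : {e : Sym2 V // e ∈ G.edgeFinset}) :
    (((univ : Finset (Gadget11 G)).filter (fun w => w.1 ∈ T)).filter
      (fun w => fav11 G w = some e)).card = (T.filter (fun u => u ∈ e.1)).card := by
  symm
  refine card_bij (fun u hu => ⟨u, some ⟨e.1, e.2, (mem_filter.1 hu).2⟩⟩)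
    (fun u hu => by simp only [mem_filter]; simpa [fav11] using (mem_filter.1 hu).1)
    (fun u _ v _ huv => congrArg Sigma.fst huv) ?_
  rintro ⟨u, _ | ⟨e', he'⟩⟩ hw
  · cases (mem_filter.1 hw).2
  · simp only [mem_filter, mem_univ, true_and] at hw
    simp only [fav11, Option.some.injEq] at hw
    obtain ⟨hu, rfl⟩ := hw
    exact ⟨u, by simpa [hu] using he'.2, rfl⟩

theorem card_filter_fst_eq {α : Type*} [Fintype α] [DecidableEq α] (n : ℕ) (a : α) :
    ((univ : Finset (α × Fin n)).filter (fun x => some x.1 = some a)).card = n := by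
  have : (univ : Finset (α × Fin n)).filter (fun x => some x.1 = some a) = {a} ×ˢ univ := by
    ext ⟨b, i⟩
    simp [eq_comm]
  rw [this, card_product]
  simp

/-- In a connected nontrivial graph, an independent set of size `h` is a set `T` of at most `h`
vertices such that each edge has at most `T.card - (h - 1)` endpoints in it. -/
theorem card_eq_and_independent_iff (hconn : G.Connected) (hcard : 2 ≤ Fintype.card V)
    {h : ℕ} (hh : 2 ≤ h) (T : Finset V) :
    (T.card = h ∧ ∀ x ∈ T, ∀ y ∈ T, x ≠ y → ¬ G.Adj x y) ↔
      T.card ≤ h ∧ ∀ e ∈ G.edgeFinset, h - 1 + (T.filter (fun u => u ∈ e)).card ≤ T.card := by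
  have : Nontrivial V := Fintype.one_lt_card_iff_nontrivial.1 hcard
  constructor
  · rintro ⟨rfl, hT⟩
    refine ⟨le_rfl, fun e he => ?_⟩
    have : (T.filter (fun u => u ∈ e)).card ≤ 1 := by
      refine card_le_one.2 fun x hx y hy => ?_
      rw [mem_filter] at hx hy
      by_contra hxy
      refine hT x hx.1 y hy.1 hxy ?_
      rwa [(Sym2.mem_and_mem_iff hxy).1 ⟨hx.2, hy.2⟩, SimpleGraph.mem_edgeFinset,
        SimpleGraph.mem_edgeSet] at he
    omega
  · rintro ⟨hle, hT⟩
    have hadj : ∀ {x y}, G.Adj x y → h - 1 + (T.filter (fun u => u ∈ s(x, y))).card ≤ T.card :=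
      fun hxy => hT _ (by simpa using hxy)
    have hnbr : ∀ x, ∃ y, G.Adj x y := fun x => hconn.preconnected.exists_adj_of_nontrivial x
    have hT1 : h - 1 ≤ T.card := by
      obtain ⟨x⟩ := hconn.nonempty
      obtain ⟨y, hxy⟩ := hnbr x
      exact (Nat.le_add_right _ _).trans (hadj hxy)
    obtain ⟨x, hx⟩ : T.Nonempty := card_pos.1 (by omega)
    obtain ⟨y, hxy⟩ := hnbr x
    have hpos : 0 < (T.filter (fun u => u ∈ s(x, y))).card := card_pos.2 ⟨x, by simp [hx]⟩
    have := hadj hxy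
    refine ⟨by omega, fun a ha b hb hab hG => ?_⟩
    have : 1 < (T.filter (fun u => u ∈ s(a, b))).card :=
      one_lt_card.2 ⟨a, by simp [ha], b, by simp [hb], hab⟩
    have := hadj hG
    omega

end GadgetScores

/-- Independent Set reduction for C-Cons-Add: candidates are p and one g_e per
edge; registered voters are h−1 g_e-voters per edge; the bundle of each gadget
voter is its whole gadget. κ is disjoint, and G has a size-h independent set
iff adding at most h bundles makes p a Plurality winner. -/
theorem stmt_11 {V : Type*} [Fintype V] [DecidableEq V]
    (G : SimpleGraph V) [DecidableRel G.Adj]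
    (hconn : G.Connected) (hcard : 2 ≤ Fintype.card V)
    (h : ℕ) (hh : 3 ≤ h)
    (κ : Gadget11 G → Finset (Gadget11 G))
    (hκ : ∀ w, κ w = Finset.univ.filter (fun w' => w'.1 = w.1)) :
    (∀ x y, κ x = κ y ∨ κ x ∩ κ y = ∅) ∧
    ((∃ U : Finset V, U.card = h ∧ ∀ x ∈ U, ∀ y ∈ U, x ≠ y → ¬ G.Adj x y) ↔
     (∃ W' : Finset (Gadget11 G), W'.card ≤ h ∧
       ∀ c : Option {e : Sym2 V // e ∈ G.edgeFinset},
         ((((Finset.univ : Finset ({e : Sym2 V // e ∈ G.edgeFinset} × Fin (h - 1))).image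
              Sum.inl ∪ (W'.biUnion κ).image Sum.inr)).filter
           (fun v => Sum.elim (fun x => some x.1) (fav11 G) v = c)).card ≤
         ((((Finset.univ : Finset ({e : Sym2 V // e ∈ G.edgeFinset} × Fin (h - 1))).image
              Sum.inl ∪ (W'.biUnion κ).image Sum.inr)).filter
           (fun v => Sum.elim (fun x => some x.1) (fav11 G) v = none)).card)) := by
  have hbi : ∀ W' : Finset (Gadget11 G),
      W'.biUnion κ = Finset.univ.filter (fun w => w.1 ∈ W'.image Sigma.fst) := by
    intro W'
    ext w
    simp only [Finset.mem_biUnion, hκ, Finset.mem_filter, Finset.mem_univ, true_and,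
      Finset.mem_image]
    exact exists_congr fun a => and_congr_right fun _ => eq_comm
  refine ⟨fun x y => ?_, ?_⟩
  · by_cases hxy : x.1 = y.1
    · exact Or.inl (by rw [hκ, hκ, hxy])
    · refine Or.inr (Finset.disjoint_iff_inter_eq_empty.1 (Finset.disjoint_left.2 fun w hx hy => ?_))
      rw [hκ, Finset.mem_filter] at hx hy
      exact hxy (hx.2.symm.trans hy.2)
  have hwin : ∀ W' : Finset (Gadget11 G),
      (∀ c : Option {e : Sym2 V // e ∈ G.edgeFinset},
         ((((Finset.univ : Finset ({e : Sym2 V // e ∈ G.edgeFinset} × Fin (h - 1))).image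
              Sum.inl ∪ (W'.biUnion κ).image Sum.inr)).filter
           (fun v => Sum.elim (fun x => some x.1) (fav11 G) v = c)).card ≤
         ((((Finset.univ : Finset ({e : Sym2 V // e ∈ G.edgeFinset} × Fin (h - 1))).image
              Sum.inl ∪ (W'.biUnion κ).image Sum.inr)).filter
           (fun v => Sum.elim (fun x => some x.1) (fav11 G) v = none)).card) ↔
      ∀ e ∈ G.edgeFinset, h - 1 + ((W'.image Sigma.fst).filter (fun u => u ∈ e)).card ≤
        (W'.image Sigma.fst).card := by
    intro W'
    rw [Option.forall, hbi]
    simp only [card_filter_image_inl_union_image_inr, card_filter_fav11_eq_none,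
      card_filter_fav11_eq_some, card_filter_fst_eq, le_refl, true_and, Subtype.forall,
      reduceCtorEq, Finset.filter_false, Finset.card_empty, zero_add]
  simp only [hwin, card_eq_and_independent_iff G hconn hcard (by omega : 2 ≤ h)]
  constructor
  · rintro ⟨U, hU, hscore⟩
    have himage : (U.image fun u => (⟨u, none⟩ : Gadget11 G)).image Sigma.fst = U := by
      rw [Finset.image_image]
      exact Finset.image_id
    exact ⟨U.image fun u => ⟨u, none⟩, Finset.card_image_le.trans hU, by rwa [himage]⟩
  · rintro ⟨W', hW', hscore⟩
    exact ⟨W'.image Sigma.fst, Finset.card_image_le.trans hW', hscore⟩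
end
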